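/- arXiv:1609.07593 — 3 statements merged into one kernel-verified Lean document; each statement's English description precedes it below -/
import Mathlib

section
/- Let L n be the number of λ-terms of natural size n. Then L 0 = 0, L 1 = 1, L 2 = 2, L 3 = 4, and for every n ≥ 4 the holonomic recurrence (n+1)·L n + (2n−1)·L (n−2) + L (n−3) + (n−4)·L (n−4) = (4n−1)·L (n−1) holds. -/
inductive Term : Type
  | idx : ℕ → Term
  | app : Term → Term → Term
  | abs : Term → Term

def Term.size : Term → ℕ
  | .idx n => n + 1
  | .app t u => t.size + u.size + 1
  | .abs t => t.size + 1

noncomputable def L (n : ℕ) : ℕ := Nat.card {t : Term // t.size = n}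

theorem Term.size_pos (t : Term) : 0 < t.size := by
  cases t <;> simp [Term.size]

/-- A term of size `n + 1` is an index, an abstraction of a term of size `n`, or an application of
two terms whose sizes sum to `n`. -/
def Term.sizeSuccEquiv (n : ℕ) :
    {t : Term // t.size = n + 1} ≃ Unit ⊕ {t : Term // t.size = n} ⊕
      (Σ p : Finset.HasAntidiagonal.antidiagonal n,
        {t : Term // t.size = p.1.1} × {t : Term // t.size = p.1.2}) where
  toFun
    | ⟨.idx _, _⟩ => .inl ()
    | ⟨.abs t, h⟩ => .inr (.inl ⟨t, Nat.succ.inj h⟩)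
    | ⟨.app t u, h⟩ => .inr (.inr ⟨⟨(t.size, u.size),
        Finset.HasAntidiagonal.mem_antidiagonal.2 (Nat.succ.inj h)⟩, ⟨t, rfl⟩, ⟨u, rfl⟩⟩)
  invFun
    | .inl _ => ⟨.idx n, rfl⟩
    | .inr (.inl t) => ⟨.abs t.1, congrArg Nat.succ t.2⟩
    | .inr (.inr ⟨p, t, u⟩) => ⟨.app t.1 u.1, by
        have h := Finset.HasAntidiagonal.mem_antidiagonal.1 p.2
        simp only [Term.size, t.2, u.2, h]⟩
  left_inv := by
    rintro ⟨t | ⟨t, u⟩ | t, h⟩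
    · obtain rfl := Nat.succ.inj h
      rfl
    · rfl
    · rfl
  right_inv := by
    rintro (_ | t | ⟨⟨⟨i, j⟩, h⟩, ⟨t, ht⟩, ⟨u, hu⟩⟩)
    · rfl
    · rfl
    · dsimp only at ht hu
      subst ht hu
      rfl

instance Term.isEmpty_size_zero : IsEmpty {t : Term // t.size = 0} :=
  ⟨fun t => t.1.size_pos.ne' t.2⟩

theorem Term.finite_size (n : ℕ) : Finite {t : Term // t.size = n} := by
  induction n using Nat.strong_induction_on with
  | _ n ih =>
    cases n with
    | zero => infer_instance
    | succ n =>
      have := ih n n.lt_succ_self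
      have (p : Finset.HasAntidiagonal.antidiagonal n) :
          Finite ({t : Term // t.size = p.1.1} × {t : Term // t.size = p.1.2}) := by
        have hp := Finset.HasAntidiagonal.mem_antidiagonal.1 p.2
        have := ih p.1.1 (by lia)
        have := ih p.1.2 (by lia)
        infer_instance
      exact .of_equiv _ (Term.sizeSuccEquiv n).symm

theorem L_zero : L 0 = 0 := Nat.card_of_isEmpty

theorem L_succ (n : ℕ) :
    L (n + 1) = 1 + (L n + ∑ p ∈ Finset.HasAntidiagonal.antidiagonal n, L p.1 * L p.2) := by
  have := Term.finite_size
  rw [L, Nat.card_congr (Term.sizeSuccEquiv n), Nat.card_sum, Nat.card_sum, Nat.card_sigma,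
    Nat.card_unique]
  simp only [Nat.card_prod]
  exact congrArg (1 + (L n + ·)) (Finset.sum_coe_sort _ fun p : ℕ × ℕ => L p.1 * L p.2)

open PowerSeries in
theorem L_genFun_eq :
    (mk fun n => (L n : ℤ)) = X * mk 1 + X * (mk fun n => (L n : ℤ)) +
      X * ((mk fun n => (L n : ℤ)) * mk fun n => (L n : ℤ)) := by
  ext n
  cases n with
  | zero => simp [L_zero]
  | succ n =>
    rw [map_add, map_add, coeff_succ_X_mul, coeff_succ_X_mul, coeff_succ_X_mul, coeff_mul]
    simp [L_succ, add_assoc]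

open PowerSeries in
/-- The series `2 X F - (1 - X)`, where `F` is the generating function of `L`, satisfies a
first-order linear differential equation with polynomial coefficients. -/
theorem L_genFun_differential_eq {E : PowerSeries ℤ}
    (hE : E = 2 * X * (mk fun n => (L n : ℤ)) - (1 - X)) :
    (1 - 4 * X + 2 * X ^ 2 + X ^ 4) * derivative ℤ E = (X ^ 3 - X ^ 2 - X - 1) * E := by
  have hF := L_genFun_eq
  set F : PowerSeries ℤ := mk fun n => (L n : ℤ)
  have hG : mk 1 * (1 - X : PowerSeries ℤ) = 1 := mk_one_mul_one_sub_eq_one ℤ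
  have hsq : (1 - X) * E ^ 2 = 1 - 3 * X - X ^ 2 - X ^ 3 := by
    rw [hE]
    linear_combination (-4 * X * (1 - X)) * hF - 4 * X ^ 2 * hG
  have hd := congrArg (derivative ℤ) hsq
  have h3 : derivative ℤ (3 : PowerSeries ℤ) = 0 := (derivative ℤ).map_natCast 3
  simp only [Derivation.leibniz, Derivation.leibniz_pow, map_sub, Derivation.map_one_eq_zero,
    derivative_X, smul_eq_mul, nsmul_eq_mul, h3] at hd
  push_cast at hd
  refine mul_left_cancel₀ (a := (C 2 : PowerSeries ℤ))
    ((map_ne_zero_iff _ C_injective).2 two_ne_zero) ?_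
  rw [show (C 2 : PowerSeries ℤ) = 2 from rfl]
  linear_combination ((1 - X) * E) * hd + (E - 2 * (1 - X) * derivative ℤ E) * hsq

open PowerSeries in
theorem L_recurrence (m : ℕ) :
    (m + 5 : ℤ) * L (m + 4) + (2 * m + 7) * L (m + 2) + L (m + 1) + m * L m =
      (4 * m + 15) * L (m + 3) := by
  have h := congrArg (coeff (m + 4)) (L_genFun_differential_eq rfl)
  set E : PowerSeries ℤ := 2 * X * (mk fun n => (L n : ℤ)) - (1 - X) with hE
  have hE2 (k : ℕ) : coeff (k + 2) E = 2 * (L (k + 1) : ℤ) := by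
    rw [hE, show (2 : PowerSeries ℤ) = C 2 from rfl, mul_assoc, map_sub, map_sub, coeff_C_mul,
      coeff_succ_X_mul, coeff_mk, coeff_one, coeff_X]
    simp
  have hE1 : m * coeff (m + 1) E = m * (2 * (L m : ℤ)) := by
    cases m with
    | zero => simp
    | succ k => rw [hE2]
  have hl : (1 - 4 * X + 2 * X ^ 2 + X ^ 4) * derivative ℤ E =
      derivative ℤ E - C 4 * (X ^ 1 * derivative ℤ E) + C 2 * (X ^ 2 * derivative ℤ E)
        + X ^ 4 * derivative ℤ E := by
    rw [show (C 4 : PowerSeries ℤ) = 4 from rfl, show (C 2 : PowerSeries ℤ) = 2 from rfl]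
    ring
  have hr : (X ^ 3 - X ^ 2 - X - 1) * E = X ^ 3 * E - X ^ 2 * E - X ^ 1 * E - E := by ring
  rw [hl, hr] at h
  simp only [map_add, map_sub, coeff_C_mul, coeff_derivative] at h
  rw [coeff_X_pow_mul _ 4 m, coeff_X_pow_mul _ 2 (m + 2), coeff_X_pow_mul _ 1 (m + 3),
    coeff_X_pow_mul _ 3 (m + 1), coeff_X_pow_mul _ 2 (m + 2), coeff_X_pow_mul _ 1 (m + 3)] at h
  simp only [coeff_derivative] at h
  rw [hE2 (m + 3), hE2 (m + 2), hE2 (m + 1), hE2 m] at h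
  push_cast at h
  simp only [add_assoc, Nat.reduceAdd] at h hE1 ⊢
  linarith

theorem L_holonomic :
    L 0 = 0 ∧ L 1 = 1 ∧ L 2 = 2 ∧ L 3 = 4 ∧
    ∀ n : ℕ, 4 ≤ n →
      (n + 1) * L n + (2 * n - 1) * L (n - 2) + L (n - 3) + (n - 4) * L (n - 4)
        = (4 * n - 1) * L (n - 1) := by
  have h1 : L 1 = 1 := by simp [L_succ, L_zero]
  have h2 : L 2 = 2 := by simp [L_succ 1, h1, L_zero, Finset.Nat.antidiagonal_succ]
  have h3 : L 3 = 4 := by simp [L_succ 2, h1, h2, L_zero, Finset.Nat.antidiagonal_succ]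
  refine ⟨L_zero, h1, h2, h3, fun n hn => ?_⟩
  obtain ⟨m, rfl⟩ := Nat.exists_eq_add_of_le' hn
  have h := L_recurrence m
  simp only [show 2 * (m + 4) - 1 = 2 * m + 7 by lia, show 4 * (m + 4) - 1 = 4 * m + 15 by lia,
    show m + 4 - 1 = m + 3 by lia, show m + 4 - 2 = m + 2 by lia,
    show m + 4 - 3 = m + 1 by lia, show m + 4 - 4 = m by lia]
  exact_mod_cast h
end

section
/- For every n ≥ 1, the number of neutral head normal forms of natural size n+1 equals the number of all λ-terms of natural size n: Nat.card {t : Term // Nhnf t ∧ size t = n+1} = L n. (This is the counting form of the generating-function identity K(z) = z + z·L∞(z).) -/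
inductive Nhnf : Term → Prop
  | idx (n : ℕ) : Nhnf (.idx n)
  | app {t : Term} (u : Term) : Nhnf t → Nhnf (.app t u)

/-- The bijection from λ-terms to the neutral head normal forms other than the index `0`,
raising the size by one. -/
def Term.toNhnf : Term → Term
  | .idx n => .idx (n + 1)
  | .app t u => .app t.toNhnf u
  | .abs t => .app (.idx 0) t

theorem Term.nhnf_toNhnf (t : Term) : Nhnf t.toNhnf := by
  induction t with
  | idx n => exact .idx _
  | app t u iht _ => exact .app u iht
  | abs t _ => exact .app t (.idx 0)

theorem Term.size_toNhnf (t : Term) : t.toNhnf.size = t.size + 1 := by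
  induction t with
  | idx n => rfl
  | app t u iht _ => simp only [toNhnf, size, iht]; omega
  | abs t _ => simp only [toNhnf, size]; omega

theorem Term.toNhnf_ne_idx_zero (t : Term) : t.toNhnf ≠ .idx 0 := by
  cases t <;> simp [toNhnf]

theorem Term.toNhnf_injective : Function.Injective Term.toNhnf := by
  intro t
  induction t with
  | idx n => intro s h; cases s <;> simp_all [toNhnf]
  | app t u iht _ =>
    intro s h
    cases s with
    | idx m => simp [toNhnf] at h
    | app t' u' =>
      simp only [toNhnf, Term.app.injEq] at h
      rw [iht h.1, h.2]
    | abs s => simp [toNhnf, toNhnf_ne_idx_zero] at h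
  | abs t _ =>
    intro s h
    cases s with
    | idx m => simp [toNhnf] at h
    | app t' u' => exact absurd (Term.app.inj h).1.symm (toNhnf_ne_idx_zero t')
    | abs s => rw [(Term.app.inj h).2]

theorem Nhnf.eq_idx_zero_or_exists_toNhnf_eq {t : Term} (h : Nhnf t) :
    t = .idx 0 ∨ ∃ s : Term, s.toNhnf = t := by
  induction h with
  | idx n =>
    cases n with
    | zero => exact .inl rfl
    | succ n => exact .inr ⟨.idx n, rfl⟩
  | app u _ ih =>
    obtain rfl | ⟨s, rfl⟩ := ih
    · exact .inr ⟨.abs u, rfl⟩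
    · exact .inr ⟨.app s u, rfl⟩

theorem nhnf_eq_lambda :
    ∀ n : ℕ, 1 ≤ n →
      Nat.card {t : Term // Nhnf t ∧ t.size = n + 1} = L n := by
  intro n hn
  refine (Nat.card_congr (Equiv.ofBijective
    (fun t : {t : Term // t.size = n} ↦
      (⟨t.1.toNhnf, t.1.nhnf_toNhnf, by rw [t.1.size_toNhnf, t.2]⟩ :
        {t : Term // Nhnf t ∧ t.size = n + 1})) ⟨?_, ?_⟩)).symm
  · intro s t h
    exact Subtype.ext (Term.toNhnf_injective (congrArg Subtype.val h))
  · rintro ⟨t, ht, hsize⟩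
    obtain rfl | ⟨s, rfl⟩ := ht.eq_idx_zero_or_exists_toNhnf_eq
    · simp only [Term.size] at hsize
      omega
    · rw [s.size_toNhnf] at hsize
      exact ⟨⟨s, by omega⟩, rfl⟩
end

section
/- For every n : ℕ, the number of λ-terms whose alternative size size₂ equals n is the same as the number of λ-terms whose natural size equals n+1: Nat.card {t : Term // size₂ t = n} = Nat.card {t : Term // size t = n+1}. (This is the counting form of the identity L∞(z) = z·A₁(z).) -/
def Term.size₂ : Term → ℕ
  | .idx n => n
  | .app t u => t.size₂ + u.size₂ + 2
  | .abs t => t.size₂ + 1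

theorem Term.size_eq_size₂_add_one (t : Term) : t.size = t.size₂ + 1 := by
  induction t with
  | idx n => rfl
  | app t u iht ihu => simp only [Term.size, Term.size₂, iht, ihu]; omega
  | abs t ih => simp only [Term.size, Term.size₂, ih]

theorem size₂_eq_size_shift :
    ∀ n : ℕ, Nat.card {t : Term // t.size₂ = n}
      = Nat.card {t : Term // t.size = n + 1} := by
  intro n
  simp only [Term.size_eq_size₂_add_one, Nat.add_right_cancel_iff]
end
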